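/- Assume additionally ε ≤ d−1. For any λ > 0, if the number of candidates N satisfies N ≥ 2(e^ε+1)²(1+λ)²/(0.24²·λ²)·ln(8(1+λ)/(0.24·λ)), then m_ss − m_mmrc ≤ λ·m_mmrc and b_ss ≤ b_mmrc. -/

import Mathlib

open scoped Classical
open Real Finset

noncomputable section

/-- The output alphabet of Subset Selection: subsets of `[d]` of size `s`. -/
def zset (d s : ℕ) : Finset (Finset (Fin d)) := Finset.powersetCard s Finset.univ

/-- Normalizing constant of the Subset Selection pmf. -/
def qssC (d s : ℕ) (ε : ℝ) : ℝ :=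
  ((d - 1).choose (s - 1) : ℝ) * Real.exp ε + ((d - 1).choose s : ℝ)

/-- The Subset Selection pmf `q^ss(A | e_j)`. -/
def qss (d s : ℕ) (ε : ℝ) (j : Fin d) (A : Finset (Fin d)) : ℝ :=
  if j ∈ A then Real.exp ε / qssC d s ε else 1 / qssC d s ε

/-- Subset Selection scaling factor `m_ss`. -/
def mss (d s : ℕ) (ε : ℝ) : ℝ :=
  (s : ℝ) * ((d : ℝ) - (s : ℝ)) * (Real.exp ε - 1) /
    (((d : ℝ) - 1) * ((s : ℝ) * (Real.exp ε - 1) + (d : ℝ)))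

/-- Subset Selection offset `b_ss`. -/
def bss (d s : ℕ) (ε : ℝ) : ℝ :=
  (s : ℝ) * (((s : ℝ) - 1) * Real.exp ε + ((d : ℝ) - (s : ℝ))) /
    (((d : ℝ) - 1) * ((s : ℝ) * (Real.exp ε - 1) + (d : ℝ)))

/-- The Subset Selection estimator `x̂^ss = (z − b_ss·𝟙)/m_ss`, coordinate `i`. -/
def xhatSS (d s : ℕ) (ε : ℝ) (A : Finset (Fin d)) (i : Fin d) : ℝ :=
  ((if i ∈ A then (1 : ℝ) else 0) - bss d s ε) / mss d s ε

/-- Expectation of `f(M/N)` for `M ~ Binomial(N, μ)`. -/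
def binomExp (N : ℕ) (μ : ℝ) (f : ℝ → ℝ) : ℝ :=
  ∑ M ∈ Finset.range (N + 1),
    (N.choose M : ℝ) * μ ^ M * (1 - μ) ^ (N - M) * f ((M : ℝ) / (N : ℝ))

/-- The in-cap selection probability of MRC given in-cap fraction `θ`. -/
def hMrc (ε θ : ℝ) : ℝ := Real.exp ε * θ / (Real.exp ε * θ + (1 - θ))

/-- MRC-simulating-Subset-Selection offset `b_mrc`. -/
def bMrcSS (d s N : ℕ) (ε : ℝ) : ℝ :=
  (1 / ((d : ℝ) - 1)) * binomExp N ((s : ℝ) / (d : ℝ)) (fun θ => (s : ℝ) - hMrc ε θ)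

/-- MRC-simulating-Subset-Selection scaling factor `m_mrc`. -/
def mMrcSS (d s N : ℕ) (ε : ℝ) : ℝ :=
  binomExp N ((s : ℝ) / (d : ℝ)) (hMrc ε) - bMrcSS d s N ε

/-- The MRC index distribution simulating Subset Selection:
`P(K = k) ∝ e^ε` for in-cap candidates and `∝ 1` for out-cap candidates. -/
def piMrcSS (d N : ℕ) (ε : ℝ) (j : Fin d) (zs : Fin N → Finset (Fin d)) (k : Fin N) : ℝ :=
  (if j ∈ zs k then Real.exp ε else 1) /
    ∑ k' : Fin N, (if j ∈ zs k' then Real.exp ε else 1)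

/-- Marginal output distribution of MRC simulating Subset Selection over
i.i.d. uniform candidates and the selected index. -/
def qMrcOut (d s N : ℕ) (ε : ℝ) (j : Fin d) (A : Finset (Fin d)) : ℝ :=
  ∑ zs ∈ Fintype.piFinset (fun _ : Fin N => zset d s),
    (1 / ((zset d s).card : ℝ)) ^ N *
      ∑ k : Fin N, if zs k = A then piMrcSS d N ε j zs k else 0

/-- The debiased MRC estimator `x̂^mrc = (Z_K − b_mrc·𝟙)/m_mrc`, coordinate `i`. -/
def xhatMrc (d s N : ℕ) (ε : ℝ) (A : Finset (Fin d)) (i : Fin d) : ℝ :=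
  ((if i ∈ A then (1 : ℝ) else 0) - bMrcSS d s N ε) / mMrcSS d s N ε

/-- The MMRC index distribution simulating Subset Selection (with `μ = s/d` and
`a = e^ε·μ + (1−μ)`). -/
def piMmrcSS (d s N : ℕ) (ε : ℝ) (j : Fin d) (zs : Fin N → Finset (Fin d)) (k : Fin N) : ℝ :=
  let θ : ℝ := ((Finset.univ.filter fun i : Fin N => j ∈ zs i).card : ℝ) / (N : ℝ)
  let μ : ℝ := (s : ℝ) / (d : ℝ)
  let a : ℝ := Real.exp ε * μ + (1 - μ)
  if θ < μ then
    (if j ∈ zs k then Real.exp ε / ((N : ℝ) * a)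
     else (1 - θ * Real.exp ε / a) / ((N : ℝ) * (1 - θ)))
  else if μ < θ then
    (if j ∈ zs k then (1 - (1 - θ) / a) / ((N : ℝ) * θ) else 1 / ((N : ℝ) * a))
  else
    (if j ∈ zs k then Real.exp ε / ((N : ℝ) * (Real.exp ε * θ + (1 - θ)))
     else 1 / ((N : ℝ) * (Real.exp ε * θ + (1 - θ))))

/-- `g(θ) = (e^ε θ/a)·1{θ≤μ} + ((e^ε μ + θ − μ)/a)·1{θ>μ}`. -/
def gMmrc (ε μ θ : ℝ) : ℝ :=
  if θ ≤ μ then Real.exp ε * θ / (Real.exp ε * μ + (1 - μ))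
  else (Real.exp ε * μ + θ - μ) / (Real.exp ε * μ + (1 - μ))

/-- `E[g(θ)]` over `N·θ ~ Binomial(N, s/d)`. -/
def egMmrc (d s N : ℕ) (ε : ℝ) : ℝ :=
  binomExp N ((s : ℝ) / (d : ℝ)) (gMmrc ε ((s : ℝ) / (d : ℝ)))

/-- MMRC-simulating-Subset-Selection scaling factor `m_mmrc`. -/
def mMmrcSS (d s N : ℕ) (ε : ℝ) : ℝ :=
  ((d : ℝ) / ((d : ℝ) - 1)) * egMmrc d s N ε - (s : ℝ) / ((d : ℝ) - 1)

/-- MMRC-simulating-Subset-Selection offset `b_mmrc`. -/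
def bMmrcSS (d s N : ℕ) (ε : ℝ) : ℝ :=
  (1 / ((d : ℝ) - 1)) * ((s : ℝ) - egMmrc d s N ε)

/-- Marginal output distribution of MMRC simulating Subset Selection over
i.i.d. uniform candidates and the selected index. -/
def qMmrcOut (d s N : ℕ) (ε : ℝ) (j : Fin d) (A : Finset (Fin d)) : ℝ :=
  ∑ zs ∈ Fintype.piFinset (fun _ : Fin N => zset d s),
    (1 / ((zset d s).card : ℝ)) ^ N *
      ∑ k : Fin N, if zs k = A then piMmrcSS d s N ε j zs k else 0

/-- The debiased MMRC estimator `x̂^mmrc = (Z_K − b_mmrc·𝟙)/m_mmrc`, coordinate `i`. -/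
def xhatMmrc (d s N : ℕ) (ε : ℝ) (A : Finset (Fin d)) (i : Fin d) : ℝ :=
  ((if i ∈ A then (1 : ℝ) else 0) - bMmrcSS d s N ε) / mMmrcSS d s N ε

/-- Per-user expected squared error of Subset Selection on one-hot input `e_j`. -/
def errSSone (d s : ℕ) (ε : ℝ) (j : Fin d) : ℝ :=
  ∑ A ∈ zset d s, qss d s ε j A *
    ∑ i : Fin d, (xhatSS d s ε A i - (if i = j then (1 : ℝ) else 0)) ^ 2

/-- Per-user expected squared error of MRC simulating Subset Selection on input `e_j`. -/
def errMrcOne (d s N : ℕ) (ε : ℝ) (j : Fin d) : ℝ :=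
  ∑ A ∈ zset d s, qMrcOut d s N ε j A *
    ∑ i : Fin d, (xhatMrc d s N ε A i - (if i = j then (1 : ℝ) else 0)) ^ 2

/-- Per-user expected squared error of MMRC simulating Subset Selection on input `e_j`. -/
def errMmrcOne (d s N : ℕ) (ε : ℝ) (j : Fin d) : ℝ :=
  ∑ A ∈ zset d s, qMmrcOut d s N ε j A *
    ∑ i : Fin d, (xhatMmrc d s N ε A i - (if i = j then (1 : ℝ) else 0)) ^ 2

/-- `n`-user frequency-estimation squared error of Subset Selection on inputs
`e_{xs 1}, …, e_{xs n}`. -/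
def errSSMech (d s n : ℕ) (ε : ℝ) (xs : Fin n → Fin d) : ℝ :=
  ∑ zt ∈ Fintype.piFinset (fun _ : Fin n => zset d s),
    (∏ i : Fin n, qss d s ε (xs i) (zt i)) *
      ∑ j : Fin d,
        ((1 / (n : ℝ)) * (∑ i : Fin n, xhatSS d s ε (zt i) j) -
            (1 / (n : ℝ)) * (∑ i : Fin n, if j = xs i then (1 : ℝ) else 0)) ^ 2

/-- `n`-user frequency-estimation squared error of MMRC simulating Subset Selection. -/
def errMmrcMech (d s N n : ℕ) (ε : ℝ) (xs : Fin n → Fin d) : ℝ :=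
  ∑ zt ∈ Fintype.piFinset (fun _ : Fin n => zset d s),
    (∏ i : Fin n, qMmrcOut d s N ε (xs i) (zt i)) *
      ∑ j : Fin d,
        ((1 / (n : ℝ)) * (∑ i : Fin n, xhatMmrc d s N ε (zt i) j) -
            (1 / (n : ℝ)) * (∑ i : Fin n, if j = xs i then (1 : ℝ) else 0)) ^ 2

lemma binomExp_quadratic {N : ℕ} (hN : 0 < N) (μ A B C : ℝ) :
    binomExp N μ (fun θ => A + B * (θ - μ) + C * (θ - μ) ^ 2) = A + C * (μ * (1 - μ) / N) := by
  have hN' : (N : ℝ) ≠ 0 := by positivity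
  have h0 := congrArg (Polynomial.eval μ) (bernsteinPolynomial.sum ℝ N)
  have h1 := congrArg (Polynomial.eval μ) (bernsteinPolynomial.sum_smul ℝ N)
  have h2 := congrArg (Polynomial.eval μ) (bernsteinPolynomial.variance ℝ N)
  simp only [Polynomial.eval_finsetSum, Polynomial.eval_mul, Polynomial.eval_pow,
    Polynomial.eval_sub, Polynomial.eval_X, Polynomial.eval_one, Polynomial.eval_natCast,
    nsmul_eq_mul, bernsteinPolynomial] at h0 h1 h2
  unfold binomExp
  have key : ∀ M ∈ range (N + 1), (N.choose M : ℝ) * μ ^ M * (1 - μ) ^ (N - M) *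
      (A + B * ((M : ℝ) / N - μ) + C * ((M : ℝ) / N - μ) ^ 2) =
      (A - B * μ) * ((N.choose M : ℝ) * μ ^ M * (1 - μ) ^ (N - M)) +
      B / N * (M * ((N.choose M : ℝ) * μ ^ M * (1 - μ) ^ (N - M))) +
      C / N ^ 2 * ((N * μ - M) ^ 2 * ((N.choose M : ℝ) * μ ^ M * (1 - μ) ^ (N - M))) := by
    intro M _
    field_simp
    ring
  rw [Finset.sum_congr rfl key, Finset.sum_add_distrib, Finset.sum_add_distrib,
    ← Finset.mul_sum, ← Finset.mul_sum, ← Finset.mul_sum, h0, h1, h2]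
  field_simp
  ring

lemma binomExp_mono {μ : ℝ} (h0 : 0 ≤ μ) (h1 : μ ≤ 1) (N : ℕ) {f g : ℝ → ℝ} (h : f ≤ g) :
    binomExp N μ f ≤ binomExp N μ g := by
  have : 0 ≤ 1 - μ := by linarith
  exact Finset.sum_le_sum fun M _ => mul_le_mul_of_nonneg_left (h _) (by positivity)

lemma binomExp_gMmrc_le {N : ℕ} (hN : 0 < N) {ε μ : ℝ} (hε : 0 ≤ ε) (h0 : 0 ≤ μ) (h1 : μ ≤ 1) :
    binomExp N μ (gMmrc ε μ) ≤ exp ε * μ / (exp ε * μ + (1 - μ)) := by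
  set a := exp ε * μ + (1 - μ) with ha
  have hE := one_le_exp hε
  have ha0 : 0 < a := by nlinarith
  have h := binomExp_quadratic hN μ (exp ε * μ / a) (exp ε / a) 0
  rw [zero_mul, add_zero] at h
  rw [← h]
  refine binomExp_mono h0 h1 N fun θ => ?_
  have e : exp ε * μ / a + exp ε / a * (θ - μ) + 0 * (θ - μ) ^ 2 = exp ε * θ / a := by ring
  simp only [e, gMmrc, ← ha]
  split_ifs with hθ
  · rfl
  · gcongr
    nlinarith

lemma le_binomExp_gMmrc {N : ℕ} (hN : 0 < N) {ε μ t : ℝ} (hε : 0 ≤ ε) (h0 : 0 ≤ μ) (h1 : μ ≤ 1)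
    (ht : 0 < t) (hNt : μ * (1 - μ) / N ≤ t ^ 2) :
    (exp ε * μ - (exp ε - 1) * (t / 2)) / (exp ε * μ + (1 - μ)) ≤ binomExp N μ (gMmrc ε μ) := by
  set a := exp ε * μ + (1 - μ) with ha
  have hE := one_le_exp hε
  have ha0 : 0 < a := by nlinarith
  have h := binomExp_quadratic hN μ ((exp ε * μ - (exp ε - 1) * (t / 4)) / a)
    ((exp ε + 1) / 2 / a) (-((exp ε - 1) / (4 * t) / a))
  calc _ ≤ (exp ε * μ - (exp ε - 1) * (t / 4)) / a +
        -((exp ε - 1) / (4 * t) / a) * (μ * (1 - μ) / N) := by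
        have : (exp ε - 1) / (4 * t) / a * (μ * (1 - μ) / N) ≤
            (exp ε - 1) / (4 * t) / a * t ^ 2 :=
          mul_le_mul_of_nonneg_left hNt
            (div_nonneg (div_nonneg (by linarith) (by positivity)) ha0.le)
        have e : (exp ε - 1) / (4 * t) / a * t ^ 2 = (exp ε - 1) * (t / 4) / a := by
          field_simp
        have e' : (exp ε * μ - (exp ε - 1) * (t / 2)) / a =
          (exp ε * μ - (exp ε - 1) * (t / 4)) / a - (exp ε - 1) * (t / 4) / a := by ring
        linarith
    _ = _ := h.symm
    _ ≤ _ := by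
        refine binomExp_mono h0 h1 N fun θ => ?_
        have e : (exp ε * μ - (exp ε - 1) * (t / 4)) / a + (exp ε + 1) / 2 / a * (θ - μ) +
            -((exp ε - 1) / (4 * t) / a) * (θ - μ) ^ 2 =
            (exp ε * θ - (exp ε - 1) * ((θ - μ + t) ^ 2 / (4 * t))) / a := by
          field_simp
          ring
        simp only [e, gMmrc, ← ha]
        have hq : 0 ≤ (θ - μ + t) ^ 2 / (4 * t) := by positivity
        have hq' : θ - μ ≤ (θ - μ + t) ^ 2 / (4 * t) := by
          rw [le_div_iff₀ (by positivity)]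
          nlinarith [sq_nonneg (θ - μ - t)]
        split_ifs with hθ
        · gcongr
          nlinarith
        · refine div_le_div_of_nonneg_right ?_ ha0.le
          nlinarith

/-- `m_ss` and `b_ss` have the same form as `m_mmrc` and `b_mmrc`, with `E[g(θ)]` replaced by the
in-cap probability `g(μ)`. -/
lemma mss_eq {d : ℕ} (hd : 2 ≤ d) (s : ℕ) {ε : ℝ} (hε : 0 ≤ ε) :
    mss d s ε = (d : ℝ) / (d - 1) *
      (exp ε * (s / d) / (exp ε * (s / d) + (1 - s / d))) - s / (d - 1) := by
  have hd' : (2 : ℝ) ≤ d := by exact_mod_cast hd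
  have h1 : (d : ℝ) - 1 ≠ 0 := by linarith
  have hE := one_le_exp hε
  have hs : (0 : ℝ) ≤ s := by positivity
  have h2 : (s : ℝ) * (exp ε - 1) + d ≠ 0 := by nlinarith
  have e : exp ε * ((s : ℝ) / d) + (1 - s / d) = (s * (exp ε - 1) + d) / d := by
    field_simp
    ring
  rw [mss, e]
  field_simp
  ring

lemma bss_eq {d : ℕ} (hd : 2 ≤ d) (s : ℕ) {ε : ℝ} (hε : 0 ≤ ε) :
    bss d s ε = 1 / ((d : ℝ) - 1) *
      (s - exp ε * (s / d) / (exp ε * (s / d) + (1 - s / d))) := by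
  have hd' : (2 : ℝ) ≤ d := by exact_mod_cast hd
  have h1 : (d : ℝ) - 1 ≠ 0 := by linarith
  have hE := one_le_exp hε
  have hs : (0 : ℝ) ≤ s := by positivity
  have h2 : (s : ℝ) * (exp ε - 1) + d ≠ 0 := by nlinarith
  have e : exp ε * ((s : ℝ) / d) + (1 - s / d) = (s * (exp ε - 1) + d) / d := by
    field_simp
    ring
  rw [bss, e]
  field_simp
  ring

lemma ceil_div_mem_bounds {d : ℕ} (hd : 2 ≤ d) {E : ℝ} (hE : 2 ≤ E) :
    1 / (1 + E) ≤ (⌈(d : ℝ) / (1 + E)⌉₊ : ℝ) / d ∧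
      (⌈(d : ℝ) / (1 + E)⌉₊ : ℝ) / d ≤ 5 / 6 := by
  have hd' : (2 : ℝ) ≤ d := by exact_mod_cast hd
  constructor
  · rw [le_div_iff₀ (by positivity), one_div_mul_eq_div]
    exact Nat.le_ceil _
  · rw [div_le_iff₀ (by positivity)]
    have h := Nat.ceil_lt_add_one (a := (d : ℝ) / (1 + E)) (by positivity)
    have : (d : ℝ) / (1 + E) ≤ d / 3 := by gcongr; linarith
    linarith

/-- **Lemma I.2.**  If `ε ≤ d−1` and `N ≥ 2(e^ε+1)²(1+λ)²/(0.24²λ²)·ln(8(1+λ)/(0.24λ))`,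
then `m_ss − m_mmrc ≤ λ·m_mmrc` and `b_ss ≤ b_mmrc`. -/
theorem mmrc_ss_scaling_close
    (d : ℕ) (hd : 2 ≤ d) (ε : ℝ) (hε1 : 1 ≤ ε) (hεd : ε ≤ (d : ℝ) - 1)
    (s : ℕ) (hs : s = ⌈(d : ℝ) / (1 + Real.exp ε)⌉₊)
    (lam : ℝ) (hlam : 0 < lam)
    (N : ℕ) (hN0 : 0 < N)
    (hN : (N : ℝ) ≥ 2 * (Real.exp ε + 1) ^ 2 * (1 + lam) ^ 2 / ((0.24 : ℝ) ^ 2 * lam ^ 2) *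
        Real.log (8 * (1 + lam) / ((0.24 : ℝ) * lam))) :
    mss d s ε - mMmrcSS d s N ε ≤ lam * mMmrcSS d s N ε ∧ bss d s ε ≤ bMmrcSS d s N ε := by
  have hε : 0 ≤ ε := by linarith
  have hE : 2 ≤ exp ε := by linarith [add_one_le_exp ε]
  have hd' : (2 : ℝ) ≤ d := by exact_mod_cast hd
  have hN' : (0 : ℝ) < N := by exact_mod_cast hN0
  obtain ⟨hμl, hμu⟩ := ceil_div_mem_bounds hd hE
  rw [← hs] at hμl hμu
  rw [mss_eq hd s hε, bss_eq hd s hε, mMmrcSS, bMmrcSS, egMmrc]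
  have hsd : (s : ℝ) = d * (s / d) := by field_simp
  set μ : ℝ := (s : ℝ) / d
  have hμ0 : 0 < μ := lt_of_lt_of_le (by positivity) hμl
  constructor
  · set v := μ * (1 - μ) with hv
    have hv0 : 0 < v := mul_pos hμ0 (by linarith)
    have hvE : 1 ≤ 6 * (exp ε + 1) * v := by
      have : 1 ≤ μ * (exp ε + 1) := by
        rw [div_le_iff₀ (by positivity)] at hμl
        linarith
      nlinarith
    set w := lam / (1 + lam) with hw
    have hw0 : 0 < w := by positivity
    have hlog : 1 ≤ log (8 * (1 + lam) / (0.24 * lam)) := by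
      rw [le_log_iff_exp_le (by positivity), le_div_iff₀ (by positivity)]
      nlinarith [exp_one_lt_d9]
    have hNw : 2 * (exp ε + 1) ^ 2 ≤ N * w ^ 2 := by
      calc 2 * (exp ε + 1) ^ 2
          ≤ 2 * (exp ε + 1) ^ 2 * (1 + lam) ^ 2 / (0.24 ^ 2 * lam ^ 2) * 1 * w ^ 2 := by
            have e : 2 * (exp ε + 1) ^ 2 * (1 + lam) ^ 2 / (0.24 ^ 2 * lam ^ 2) * 1 * w ^ 2 =
                2 * (exp ε + 1) ^ 2 / 0.24 ^ 2 := by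
              rw [hw]
              field_simp
            rw [e, le_div_iff₀ (by norm_num)]
            nlinarith [sq_nonneg (exp ε + 1)]
        _ ≤ 2 * (exp ε + 1) ^ 2 * (1 + lam) ^ 2 / (0.24 ^ 2 * lam ^ 2) *
              log (8 * (1 + lam) / (0.24 * lam)) * w ^ 2 := by gcongr
        _ ≤ N * w ^ 2 := by gcongr
    have hNt : v / N ≤ (2 * w * v) ^ 2 := by
      rw [div_le_iff₀ hN']
      have h1 : 1 ≤ 4 * (N * w ^ 2) * v := by
        have : 4 * (2 * (exp ε + 1) ^ 2) * v ≤ 4 * (N * w ^ 2) * v := by gcongr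
        nlinarith [mul_pos (by positivity : 0 < exp ε + 1) hv0]
      nlinarith
    have hlow := le_binomExp_gMmrc hN0 hε hμ0.le (by linarith) (by positivity) hNt
    set G := binomExp N μ (gMmrc ε μ)
    set a := exp ε * μ + (1 - μ) with ha
    have ha0 : 0 < a := by nlinarith
    have hlow' : (1 + lam) * (exp ε * μ / a) - lam * ((exp ε - 1) * v / a) ≤ (1 + lam) * G := by
      refine le_trans (le_of_eq ?_) (mul_le_mul_of_nonneg_left hlow (by positivity))
      rw [hw]
      field_simp
    have hp : (exp ε - 1) * v / a = exp ε * μ / a - μ := by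
      rw [eq_sub_iff_add_eq, div_add' _ _ _ ha0.ne', hv, ha]
      ring
    rw [hp] at hlow'
    have hd1 : (0 : ℝ) < d - 1 := by linarith
    have key : 0 ≤ d / (d - 1) * ((1 + lam) * G -
        ((1 + lam) * (exp ε * μ / a) - lam * (exp ε * μ / a - μ))) :=
      mul_nonneg (by positivity) (by linarith)
    have hsd' : (s : ℝ) / (d - 1) = d / (d - 1) * μ := by
      conv_lhs => rw [hsd]
      ring
    rw [hsd']
    nlinarith
  · have hup := binomExp_gMmrc_le hN0 hε hμ0.le (by linarith)
    have : (0 : ℝ) < d - 1 := by linarith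
    gcongr
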